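/- Let (G, Γ*) be a self-similar groupoid with collapsed self-similar groupoid (L, Λ*) via the maps α: G → L and β: Γ* → Λ*. Fix a vertex v ∈ Γ⁰, let H = G ∩ Iso(v, v) be the isotropy group at v, let KH denote the K-span of H in KS_{(G,Γ*)}, and extend α linearly to KH. Then for every a ∈ KH and every p ∈ vΓ*, ap = 0 in KS_{(G,Γ*)} if and only if α(a)β(p) = 0 in KS_{(L,Λ*)}. -/

import Mathlib

set_option autoImplicit false

/-! ## Directed graphs and path trees -/

/-- A row-finite directed graph. -/
structure DirGraph where
  V : Type
  E : Type
  src : E → V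
  rng : E → V
  rowFinite : ∀ v : V, {e : E | src e = v}.Finite

/-- `Γ.IsPathFrom v l` : the list of edges `l` is a (finite) path with source `v`. -/
def DirGraph.IsPathFrom (Γ : DirGraph) : Γ.V → List Γ.E → Prop
  | _, [] => True
  | v, e :: l => Γ.src e = v ∧ DirGraph.IsPathFrom Γ (Γ.rng e) l

/-- The range (terminal vertex) of a path with source `v` and edge list `l`. -/
def DirGraph.rng0 (Γ : DirGraph) : Γ.V → List Γ.E → Γ.V
  | v, [] => v
  | _, e :: l => DirGraph.rng0 Γ (Γ.rng e) l

/-- An isomorphism of rooted path trees `(dom)Γ* → (cod)Γ*`: a bijection between the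
paths with source `dom` and the paths with source `cod` which fixes the root and maps
children to children (equivalently, a directed-graph isomorphism of the rooted trees). -/
structure Arrow (Γ : DirGraph) where
  dom : Γ.V
  cod : Γ.V
  act : List Γ.E → List Γ.E
  inv : List Γ.E → List Γ.E
  act_maps : ∀ l, Γ.IsPathFrom dom l → Γ.IsPathFrom cod (act l)
  inv_maps : ∀ l, Γ.IsPathFrom cod l → Γ.IsPathFrom dom (inv l)
  left_inv : ∀ l, Γ.IsPathFrom dom l → inv (act l) = l
  right_inv : ∀ l, Γ.IsPathFrom cod l → act (inv l) = l
  act_nil : act [] = []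
  act_snoc : ∀ l e, Γ.IsPathFrom dom (l ++ [e]) → ∃ e', act (l ++ [e]) = act l ++ [e']

/-- The identity tree isomorphism at a vertex `v`. -/
def Arrow.idArrow (Γ : DirGraph) (v : Γ.V) : Arrow Γ where
  dom := v
  cod := v
  act := fun l => l
  inv := fun l => l
  act_maps := fun _ h => h
  inv_maps := fun _ h => h
  left_inv := fun _ _ => rfl
  right_inv := fun _ _ => rfl
  act_nil := rfl
  act_snoc := fun _ e _ => ⟨e, rfl⟩

namespace Arrow

variable {Γ : DirGraph}

/-- Two arrows represent the same tree isomorphism (they agree on all genuine paths). -/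
def Same (g h : Arrow Γ) : Prop :=
  g.dom = h.dom ∧ g.cod = h.cod ∧ ∀ l, Γ.IsPathFrom g.dom l → g.act l = h.act l

/-- `k` represents the identity isomorphism of `v Γ*`. -/
def IsIdArrow (v : Γ.V) (k : Arrow Γ) : Prop :=
  k.dom = v ∧ k.cod = v ∧ ∀ l, Γ.IsPathFrom v l → k.act l = l

/-- `k` represents the composition `g ∘ h` (first `h`, then `g`). -/
def IsComposition (g h k : Arrow Γ) : Prop :=
  h.cod = g.dom ∧ k.dom = h.dom ∧ k.cod = g.cod ∧
  ∀ l, Γ.IsPathFrom h.dom l → k.act l = g.act (h.act l)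

/-- `k` represents the inverse isomorphism of `g`. -/
def IsInverseArrow (g k : Arrow Γ) : Prop :=
  k.dom = g.cod ∧ k.cod = g.dom ∧ ∀ l, Γ.IsPathFrom g.dom l → k.act (g.act l) = l

/-- `h` represents the restriction `g|_p` of `g` to the path `p`, characterized by
`g(pq) = g(p)·h(q)` for all paths `q` with source `r(p)`. -/
def IsRestrictOf (g : Arrow Γ) (p : List Γ.E) (h : Arrow Γ) : Prop :=
  h.dom = Γ.rng0 g.dom p ∧ h.cod = Γ.rng0 g.cod (g.act p) ∧
  ∀ q, Γ.IsPathFrom (Γ.rng0 g.dom p) q → g.act (p ++ q) = g.act p ++ h.act q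

end Arrow

/-! ## Self-similar groupoids -/

/-- A self-similar groupoid `(G, Γ*)` : a set of tree isomorphisms (closed under
representing-the-same-isomorphism) which contains all the identities, is closed under
composition and inverses (a groupoid with object set `Γ⁰` acting faithfully on `Γ*`),
and is closed under restriction: for every `g ∈ G` and edge `e` in the domain of `g`
there is `g|_e ∈ G` with `g(ep) = g(e)·g|_e(p)`. -/
structure SSG (Γ : DirGraph) where
  carrier : Set (Arrow Γ)
  satur : ∀ g g', g ∈ carrier → g.Same g' → g' ∈ carrier
  id_mem : ∀ v, Arrow.idArrow Γ v ∈ carrier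
  comp_mem : ∀ g h k, g ∈ carrier → h ∈ carrier → Arrow.IsComposition g h k → k ∈ carrier
  inv_mem : ∀ g k, g ∈ carrier → Arrow.IsInverseArrow g k → k ∈ carrier
  restrict_mem : ∀ g ∈ carrier, ∀ e : Γ.E, Γ.src e = g.dom →
    ∃ h ∈ carrier, g.IsRestrictOf [e] h

/-- The condition: for each pair of distinct vertices `v, w` there exist paths
`p ∈ wΓ*` and `q ∈ vΓ*` such that `G` intersects `Iso(r(p), v)` and `Iso(r(q), w)`. -/
def OrbitCond (Γ : DirGraph) (Gs : SSG Γ) : Prop :=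
  ∀ v w : Γ.V, v ≠ w →
    (∃ p, Γ.IsPathFrom w p ∧ ∃ g ∈ Gs.carrier, g.dom = Γ.rng0 w p ∧ g.cod = v) ∧
    (∃ q, Γ.IsPathFrom v q ∧ ∃ g ∈ Gs.carrier, g.dom = Γ.rng0 v q ∧ g.cod = w)

/-- Type (CF): every vertex emits more than one edge, and the orbit condition holds. -/
def TypeCF (Γ : DirGraph) (Gs : SSG Γ) : Prop :=
  (∀ v : Γ.V, ∃ e f : Γ.E, e ≠ f ∧ Γ.src e = v ∧ Γ.src f = v) ∧ OrbitCond Γ Gs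

/-! ## Contracting self-similar groupoids, nuclei, recurrent subgroups -/

/-- Every element of `G` eventually restricts into `A`. -/
def ContractsInto {Γ : DirGraph} (Gs : SSG Γ) (A : Set (Arrow Γ)) : Prop :=
  ∀ g ∈ Gs.carrier, ∃ n : ℕ, ∀ l, Γ.IsPathFrom g.dom l → l.length = n →
    ∃ h ∈ A, g.IsRestrictOf l h

/-- A set of arrows covering only finitely many tree isomorphisms. -/
def FinUpToSame {Γ : DirGraph} (A : Set (Arrow Γ)) : Prop :=
  ∃ B : Finset (Arrow Γ), ∀ g ∈ A, ∃ h ∈ B, g.Same h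

/-- `(G, Γ*)` is contracting. -/
def IsContracting {Γ : DirGraph} (Gs : SSG Γ) : Prop :=
  ∃ A : Set (Arrow Γ), A ⊆ Gs.carrier ∧ FinUpToSame A ∧ ContractsInto Gs A

/-- `N` is the nucleus of `(G, Γ*)` : a minimal finite subset of `G` into which every
element of `G` eventually restricts. -/
def IsNucleus {Γ : DirGraph} (Gs : SSG Γ) (N : Set (Arrow Γ)) : Prop :=
  N ⊆ Gs.carrier ∧ FinUpToSame N ∧ ContractsInto Gs N ∧
  ∀ A : Set (Arrow Γ), A ⊆ Gs.carrier → FinUpToSame A → ContractsInto Gs A →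
    ∀ g ∈ N, ∃ h ∈ A, g.Same h

/-- The recurrent set `H_p = {g ∈ G : g(p) = p, g|_p = g}` for a path `p ∈ vΓ*`. -/
def Hp {Γ : DirGraph} (Gs : SSG Γ) (v : Γ.V) (p : List Γ.E) : Set (Arrow Γ) :=
  {g | g ∈ Gs.carrier ∧ g.dom = v ∧ g.cod = v ∧ g.act p = p ∧ g.IsRestrictOf p g}

/-! ## The associated inverse semigroup `S_{(G,Γ*)}` -/

/-- The product in `S` of a path: `p = e₁ e₂ ⋯ eₙ · r(p)` (just `v` for the empty path). -/
def pathProd {Γ : DirGraph} {S : Type} (mul : S → S → S) (ιV : Γ.V → S) (ιE : Γ.E → S)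
    (v : Γ.V) (p : List Γ.E) : S :=
  p.foldr (fun e a => mul (ιE e) a) (ιV (Γ.rng0 v p))

/-- The inverse semigroup with zero `S_{(G,Γ*)}` associated to a self-similar groupoid,
presented through its characterizing properties: it is an inverse semigroup with zero,
generated by `Γ⁰ ∪ Γ¹ ∪ Γ⁻¹ ∪ G` subject to the defining relations, in which every
nonzero element has a unique canonical form `p g q*`. -/
structure AssocISG (Γ : DirGraph) (Gs : SSG Γ) where
  S : Type
  mul : S → S → S
  zero : S
  star : S → S
  mul_assoc : ∀ a b c, mul (mul a b) c = mul a (mul b c)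
  zero_mul : ∀ a, mul zero a = zero
  mul_zero : ∀ a, mul a zero = zero
  inv_ax : ∀ a, mul (mul a (star a)) a = a ∧ mul (mul (star a) a) (star a) = star a
  inv_unique : ∀ a b, mul (mul a b) a = a → mul (mul b a) b = b → b = star a
  ιV : Γ.V → S
  ιE : Γ.E → S
  ιG : Arrow Γ → S
  ιG_same : ∀ g h, g.Same h → ιG g = ιG h
  rel_src : ∀ e, mul (ιV (Γ.src e)) (ιE e) = ιE e
  rel_rng : ∀ e, mul (ιE e) (ιV (Γ.rng e)) = ιE e
  rel_vv : ∀ u v, u ≠ v → mul (ιV u) (ιV v) = zero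
  rel_v_idem : ∀ v, mul (ιV v) (ιV v) = ιV v
  rel_star_v : ∀ v, star (ιV v) = ιV v
  rel_ef : ∀ e f, e ≠ f → mul (star (ιE e)) (ιE f) = zero
  rel_ee : ∀ e, mul (star (ιE e)) (ιE e) = ιV (Γ.rng e)
  rel_comp : ∀ g h k, g ∈ Gs.carrier → h ∈ Gs.carrier → Arrow.IsComposition g h k →
    mul (ιG g) (ιG h) = ιG k
  rel_notcomp : ∀ g h, g ∈ Gs.carrier → h ∈ Gs.carrier → h.cod ≠ g.dom →
    mul (ιG g) (ιG h) = zero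
  rel_star : ∀ g k, g ∈ Gs.carrier → Arrow.IsInverseArrow g k → star (ιG g) = ιG k
  rel_id : ∀ v, ιG (Arrow.idArrow Γ v) = ιV v
  rel_ge : ∀ g ∈ Gs.carrier, ∀ (e e' : Γ.E) (h : Arrow Γ), Γ.src e = g.dom →
    g.act [e] = [e'] → g.IsRestrictOf [e] h → mul (ιG g) (ιE e) = mul (ιE e') (ιG h)
  canon_ex : ∀ s, s ≠ zero → ∃ (v w : Γ.V) (p q : List Γ.E) (g : Arrow Γ),
    Γ.IsPathFrom v p ∧ Γ.IsPathFrom w q ∧ g ∈ Gs.carrier ∧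
    g.dom = Γ.rng0 w q ∧ g.cod = Γ.rng0 v p ∧
    s = mul (mul (pathProd mul ιV ιE v p) (ιG g)) (star (pathProd mul ιV ιE w q))
  canon_nonzero : ∀ (v w : Γ.V) (p q : List Γ.E) (g : Arrow Γ),
    Γ.IsPathFrom v p → Γ.IsPathFrom w q → g ∈ Gs.carrier →
    g.dom = Γ.rng0 w q → g.cod = Γ.rng0 v p →
    mul (mul (pathProd mul ιV ιE v p) (ιG g)) (star (pathProd mul ιV ιE w q)) ≠ zero
  canon_inj : ∀ (v w v' w' : Γ.V) (p q p' q' : List Γ.E) (g g' : Arrow Γ),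
    Γ.IsPathFrom v p → Γ.IsPathFrom w q → g ∈ Gs.carrier →
    g.dom = Γ.rng0 w q → g.cod = Γ.rng0 v p →
    Γ.IsPathFrom v' p' → Γ.IsPathFrom w' q' → g' ∈ Gs.carrier →
    g'.dom = Γ.rng0 w' q' → g'.cod = Γ.rng0 v' p' →
    mul (mul (pathProd mul ιV ιE v p) (ιG g)) (star (pathProd mul ιV ιE w q)) =
      mul (mul (pathProd mul ιV ιE v' p') (ιG g')) (star (pathProd mul ιV ιE w' q')) →
    v = v' ∧ w = w' ∧ p = p' ∧ q = q' ∧ g.Same g'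

namespace AssocISG

variable {Γ : DirGraph} {Gs : SSG Γ}

/-- The element of `S` represented by a path. -/
def P (T : AssocISG Γ Gs) (v : Γ.V) (p : List Γ.E) : T.S :=
  pathProd T.mul T.ιV T.ιE v p

def IsIdem (T : AssocISG Γ Gs) (e : T.S) : Prop := T.mul e e = e

/-- The natural partial order on idempotents: `f ≤ e` iff `f = g e` for an idempotent `g`. -/
def idemLe (T : AssocISG Γ Gs) (f e : T.S) : Prop := ∃ g, T.IsIdem g ∧ f = T.mul g e

/-- A congruence on `S`. -/
def IsCongruence (T : AssocISG Γ Gs) (r : T.S → T.S → Prop) : Prop :=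
  Equivalence r ∧ ∀ a b c, r a b → r (T.mul c a) (T.mul c b) ∧ r (T.mul a c) (T.mul b c)

/-- `S` is congruence-free: its only congruences are equality and the universal relation. -/
def CongruenceFree (T : AssocISG Γ Gs) : Prop :=
  ∀ r, T.IsCongruence r → (∀ a b, r a b ↔ a = b) ∨ (∀ a b, r a b)

/-- `S` is fundamental. -/
def Fundamental (T : AssocISG Γ Gs) : Prop :=
  ∀ a b : T.S,
    (∀ e, T.IsIdem e → T.mul (T.mul a e) (T.star a) = T.mul (T.mul b e) (T.star b)) → a = b

/-- `S` is 0-simple: its only (two-sided semigroup) ideals are `{0}` and `S`. -/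
def ZeroSimple (T : AssocISG Γ Gs) : Prop :=
  ∀ J : Set T.S, J.Nonempty → (∀ s x, x ∈ J → T.mul s x ∈ J ∧ T.mul x s ∈ J) →
    J = {T.zero} ∨ J = Set.univ

/-- The semilattice of idempotents of `S` is 0-disjunctive. -/
def ZeroDisjunctive (T : AssocISG Γ Gs) : Prop :=
  ∀ e f, T.IsIdem e → T.IsIdem f → e ≠ T.zero → f ≠ T.zero → e ≠ f →
    ∃ h, T.IsIdem h ∧ Xor' (T.mul e h = T.zero) (T.mul f h = T.zero)

end AssocISG

/-! ## The contracted inverse semigroup algebra `K S_{(G,Γ*)}` -/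

/-- The contracted inverse semigroup algebra of `S_{(G,Γ*)}` over a field `K` :
a (possibly nonunital) `K`-algebra with basis `S ∖ {0}` and multiplication extending
that of `S` (identifying the zeros of `S` and `K`). -/
structure ContractedAlg (K : Type) [Field K] {Γ : DirGraph} {Gs : SSG Γ}
    (T : AssocISG Γ Gs) where
  A : Type
  [ringA : NonUnitalRing A]
  [modA : Module K A]
  smul_mul : ∀ (k : K) (a b : A), (k • a) * b = k • (a * b)
  mul_smul_comm : ∀ (k : K) (a b : A), a * (k • b) = k • (a * b)
  δ : T.S → A
  δ_zero : δ T.zero = 0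
  δ_mul : ∀ s t, δ (T.mul s t) = δ s * δ t
  indep : LinearIndependent K (fun s : {s : T.S // s ≠ T.zero} => δ s.1)
  spans : ∀ a : A, a ∈ Submodule.span K (Set.range (fun s : {s : T.S // s ≠ T.zero} => δ s.1))

attribute [instance] ContractedAlg.ringA ContractedAlg.modA

/-- Product of a list in a (nonunital) ring, with the empty product read as `0`. -/
def listProd {A : Type} [Mul A] [Zero A] : List A → A
  | [] => 0
  | a :: l => l.foldl (· * ·) a

namespace ContractedAlg

variable {K : Type} [Field K] {Γ : DirGraph} {Gs : SSG Γ} {T : AssocISG Γ Gs}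

/-- A (two-sided, `K`-linear) ideal of the algebra, as a set. -/
def IsIdealSet (C : ContractedAlg K T) (J : Set C.A) : Prop :=
  (0 : C.A) ∈ J ∧ (∀ x y, x ∈ J → y ∈ J → x + y ∈ J) ∧ (∀ x, x ∈ J → -x ∈ J) ∧
  (∀ (k : K) x, x ∈ J → k • x ∈ J) ∧
  (∀ x y, x ∈ J → y * x ∈ J) ∧ (∀ x y, x ∈ J → x * y ∈ J)

/-- The ideal generated by a set. -/
def idealGen (C : ContractedAlg K T) (X : Set C.A) : Set C.A :=
  ⋂₀ {J | C.IsIdealSet J ∧ X ⊆ J}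

/-- The generators `∏_{f ∈ F} (e - f)` of the tight ideal, for `e` a nonzero idempotent
and `F` a finite cover of `e`. -/
def tightGens (C : ContractedAlg K T) : Set C.A :=
  {x | ∃ (e : T.S) (l : List T.S), T.IsIdem e ∧ e ≠ T.zero ∧ l ≠ [] ∧
    (∀ f ∈ l, T.IsIdem f ∧ T.idemLe f e) ∧
    (∀ g, T.IsIdem g → g ≠ T.zero → T.idemLe g e → ∃ f ∈ l, T.mul g f ≠ T.zero) ∧
    x = listProd (l.map fun f => C.δ e - C.δ f)}

/-- The tight ideal of `K S_{(G,Γ*)}`. -/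
def Itight (C : ContractedAlg K T) : Set C.A := C.idealGen C.tightGens

/-- The Cuntz–Krieger generators `v - ∑_{e ∈ vΓ¹} e e*`. -/
def ckGens (C : ContractedAlg K T) : Set C.A :=
  {x | ∃ v : Γ.V,
    x = C.δ (T.ιV v) -
      ∑ e ∈ (Γ.rowFinite v).toFinset, C.δ (T.mul (T.ιE e) (T.star (T.ιE e)))}

/-- The Cuntz–Krieger ideal of `K S_{(G,Γ*)}`. -/
def Ick (C : ContractedAlg K T) : Set C.A := C.idealGen C.ckGens

/-- An element `a` is singular: for every nonzero idempotent `e` there is a nonzero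
idempotent `f ≤ e` with `a f = 0`. -/
def IsSingular (C : ContractedAlg K T) (a : C.A) : Prop :=
  ∀ e, T.IsIdem e → e ≠ T.zero →
    ∃ f, T.IsIdem f ∧ f ≠ T.zero ∧ T.idemLe f e ∧ a * C.δ f = 0

/-- The essential (singular) ideal of `K S_{(G,Γ*)}`. -/
def Iess (C : ContractedAlg K T) : Set C.A := {a | C.IsSingular a}

/-- The quotient of the algebra by the ideal `I` is simple. -/
def QuotSimple (C : ContractedAlg K T) (I : Set C.A) : Prop :=
  I ≠ Set.univ ∧ ∀ J, C.IsIdealSet J → I ⊆ J → J = I ∨ J = Set.univ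

end ContractedAlg
/-! ## Collapsing self-similar groupoids -/

/-- A morphism of directed graphs. -/
structure GraphHom (Γ Λ : DirGraph) where
  vmap : Γ.V → Λ.V
  emap : Γ.E → Λ.E
  hsrc : ∀ e, Λ.src (emap e) = vmap (Γ.src e)
  hrng : ∀ e, Λ.rng (emap e) = vmap (Γ.rng e)

/-- The induced map on paths. -/
def GraphHom.pmap {Γ Λ : DirGraph} (β : GraphHom Γ Λ) (l : List Γ.E) : List Λ.E :=
  l.map β.emap

/-- `F` is a system of collapsing isomorphisms for `(G, Γ*)` : a wide subgroupoid of `G`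
containing all identities, with at most one arrow between any two objects, and with an
arrow `u → v` whenever `G` has one (as produced by choosing orbit representatives `R`
and isomorphisms `f_u` with `id_u = f_u⁻¹ id_v f_u`). -/
def IsFsystem {Γ : DirGraph} (Gs : SSG Γ) (F : Set (Arrow Γ)) : Prop :=
  F ⊆ Gs.carrier ∧
  (∀ g g', g ∈ F → g.Same g' → g' ∈ F) ∧
  (∀ v, Arrow.idArrow Γ v ∈ F) ∧
  (∀ g h k, g ∈ F → h ∈ F → Arrow.IsComposition g h k → k ∈ F) ∧
  (∀ g k, g ∈ F → Arrow.IsInverseArrow g k → k ∈ F) ∧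
  (∀ g g', g ∈ F → g' ∈ F → g.dom = g'.dom → g.cod = g'.cod → g.Same g') ∧
  (∀ g ∈ Gs.carrier, ∃ f ∈ F, f.dom = g.dom ∧ f.cod = g.cod)

/-- `β : Γ → Λ` is the quotient graph morphism determined by `F` : it is surjective and
locally bijective, its vertex fibres are exactly the `F`-orbits of vertices, and it is
invariant under the action of `F` on paths (so that the fibres on paths are exactly the
`∼_F`-classes). -/
def IsCollapse {Γ Λ : DirGraph} (Gs : SSG Γ) (F : Set (Arrow Γ)) (β : GraphHom Γ Λ) : Prop :=
  Function.Surjective β.vmap ∧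
  (∀ v : Γ.V, Set.BijOn β.emap {e | Γ.src e = v} {e' | Λ.src e' = β.vmap v}) ∧
  (∀ u v : Γ.V, β.vmap u = β.vmap v ↔ ∃ f ∈ F, f.dom = u ∧ f.cod = v) ∧
  (∀ f ∈ F, ∀ l, Γ.IsPathFrom f.dom l → β.pmap (f.act l) = β.pmap l)

/-- `m` is the tree isomorphism of `Λ*` induced by `g` under the identification `β`
(the image `α(g)` of `g` in the collapsed groupoid). -/
def IsPushArrow {Γ Λ : DirGraph} (β : GraphHom Γ Λ) (g : Arrow Γ) (m : Arrow Λ) : Prop :=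
  m.dom = β.vmap g.dom ∧ m.cod = β.vmap g.cod ∧
  ∀ l, Γ.IsPathFrom g.dom l → m.act (β.pmap l) = β.pmap (g.act l)

/-- The collapsed groupoid `L = α(G)`, acting on `Λ*`. -/
def Lcarrier {Γ Λ : DirGraph} (Gs : SSG Γ) (β : GraphHom Γ Λ) : Set (Arrow Λ) :=
  {m | ∃ g ∈ Gs.carrier, IsPushArrow β g m}

/-! ## The graph Δ : cycles of the Moore diagram, the sets `I_q`, synchronization -/

/-- Membership in `N` up to representing the same tree isomorphism. -/
def memSame {Γ : DirGraph} (N : Set (Arrow Γ)) (g : Arrow Γ) : Prop :=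
  ∃ h ∈ N, g.Same h

/-- The set `C` of elements of the nucleus `N` lying on a nonempty cycle of the subgraph
`H` of the Moore diagram of `N` consisting of the edges labelled `(e, e)` : `g ∈ C` iff
`g ∈ N` and there is a nonempty path `p` with `g(p) = p`, `g|_p = g`, and all the
intermediate restrictions `g|_{p'}` (for prefixes `p'` of `p`) in `N`. -/
def Cset {Γ : DirGraph} (N : Set (Arrow Γ)) : Set (Arrow Γ) :=
  {g | memSame N g ∧ ∃ p : List Γ.E, p ≠ [] ∧ Γ.IsPathFrom g.dom p ∧ g.act p = p ∧
    g.IsRestrictOf p g ∧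
    ∀ l₁ l₂ : List Γ.E, p = l₁ ++ l₂ → ∃ h, memSame N h ∧ g.IsRestrictOf l₁ h}

/-- The vertex `I_q = q · {id_{r(q)}} = {g ∈ C : g(q) = q, g|_q = id}` of `Δ`,
for a path `q ∈ vΓ*`. -/
def Iq {Γ : DirGraph} (N : Set (Arrow Γ)) (v : Γ.V) (q : List Γ.E) : Set (Arrow Γ) :=
  {g | g ∈ Cset N ∧ g.dom = v ∧ g.cod = v ∧
    ∀ w, Γ.IsPathFrom (Γ.rng0 v q) w → g.act (q ++ w) = q ++ w}

/-- The path `p ∈ vΓ*` is synchronizing in `Δ` : every path of `Δ` labelled by the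
reversal of `p` ends at the same vertex, i.e. `I_{pq} = I_{pq'}` for all `q, q' ∈ r(p)Γ*`. -/
def Synchronizing {Γ : DirGraph} (N : Set (Arrow Γ)) (v : Γ.V) (p : List Γ.E) : Prop :=
  Γ.IsPathFrom v p ∧
  ∀ q q', Γ.IsPathFrom (Γ.rng0 v p) q → Γ.IsPathFrom (Γ.rng0 v p) q' →
    Iq N v (p ++ q) = Iq N v (p ++ q')

/-- A vertex `X` of `Δ` is synchronized: `X = I_w` for some synchronizing path `w`. -/
def SyncVertex {Γ : DirGraph} (N : Set (Arrow Γ)) (X : Set (Arrow Γ)) : Prop :=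
  ∃ v p, Synchronizing N v p ∧ X = Iq N v p

/-- The vertex set `Q = {I_q : q ∈ Γ*}` of the Schreier graph `Δ`. -/
def Qset {Γ : DirGraph} (N : Set (Arrow Γ)) : Set (Set (Arrow Γ)) :=
  {X | ∃ v q, Γ.IsPathFrom v q ∧ X = Iq N v q}

/-- The edge relation of `Δ` : an edge labelled `e` from `I_q` to `I_{eq}`. -/
def DeltaStep {Γ : DirGraph} (N : Set (Arrow Γ)) (X Y : Set (Arrow Γ)) : Prop :=
  ∃ v q e, Γ.IsPathFrom v q ∧ Γ.rng e = v ∧ X = Iq N v q ∧ Y = Iq N (Γ.src e) (e :: q)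

/-- Reachability in `Δ`. -/
def DeltaReaches {Γ : DirGraph} (N : Set (Arrow Γ)) : Set (Arrow Γ) → Set (Arrow Γ) → Prop :=
  Relation.ReflTransGen (DeltaStep N)

/-- A vertex of `Δ` lying in a minimal strongly connected component with respect to
reachability. -/
def DeltaMinVert {Γ : DirGraph} (N : Set (Arrow Γ)) (X : Set (Arrow Γ)) : Prop :=
  X ∈ Qset N ∧ ∀ Y ∈ Qset N, DeltaReaches N X Y → DeltaReaches N Y X

/- `π_{p,q}(a) = 0` for `a = ∑_{g ∈ Tset} c_g · g ∈ K H_p`, where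
`π_{p,q} : K H_p → K[H_p / (H_p ∩ I_q)]` is induced by the canonical map of `H_p` onto
the left cosets of `H_p ∩ I_q` : the sum of the coefficients over each left coset of
`H_p ∩ I_q` vanishes. -/
open Classical in
def PiZero (K : Type) [Field K] {Γ : DirGraph} (Gs : SSG Γ) (N : Set (Arrow Γ))
    (v : Γ.V) (p q : List Γ.E) (Tset : Finset (Arrow Γ)) (c : Arrow Γ → K) : Prop :=
  ∀ g₀ ∈ Hp Gs v p,
    (∑ h ∈ Tset,
      if ∃ k, k ∈ Hp Gs v p ∧ k ∈ Iq N v q ∧ Arrow.IsComposition g₀ k h then c h else 0) = 0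

/-! ## Paths and restrictions -/

namespace DirGraph

theorem isPathFrom_append (Γ : DirGraph) (v : Γ.V) (p q : List Γ.E) :
    Γ.IsPathFrom v (p ++ q) ↔ Γ.IsPathFrom v p ∧ Γ.IsPathFrom (Γ.rng0 v p) q := by
  induction p generalizing v with
  | nil => simp [IsPathFrom, rng0]
  | cons e l ih => simp [IsPathFrom, rng0, ih, and_assoc]

end DirGraph

namespace GraphHom

variable {Γ Λ : DirGraph} (β : GraphHom Γ Λ)

theorem isPathFrom_pmap {v : Γ.V} {p : List Γ.E} (hp : Γ.IsPathFrom v p) :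
    Λ.IsPathFrom (β.vmap v) (β.pmap p) := by
  induction p generalizing v with
  | nil => trivial
  | cons e l ih =>
    obtain ⟨rfl, hl⟩ := hp
    exact ⟨β.hsrc e, (β.hrng e).symm ▸ ih hl⟩

theorem rng0_pmap (v : Γ.V) (p : List Γ.E) :
    Λ.rng0 (β.vmap v) (β.pmap p) = β.vmap (Γ.rng0 v p) := by
  induction p generalizing v with
  | nil => rfl
  | cons e l ih =>
    change Λ.rng0 (Λ.rng (β.emap e)) (β.pmap l) = β.vmap (Γ.rng0 (Γ.rng e) l)
    rw [β.hrng, ih]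

theorem pmap_append (p q : List Γ.E) : β.pmap (p ++ q) = β.pmap p ++ β.pmap q :=
  List.map_append

variable {β}

theorem exists_pmap_eq
    (hloc : ∀ v : Γ.V, Set.BijOn β.emap {e | Γ.src e = v} {e' | Λ.src e' = β.vmap v})
    {v : Γ.V} {q' : List Λ.E} (hq' : Λ.IsPathFrom (β.vmap v) q') :
    ∃ q, Γ.IsPathFrom v q ∧ β.pmap q = q' := by
  induction q' generalizing v with
  | nil => exact ⟨[], trivial, rfl⟩
  | cons e' l ih =>
    obtain ⟨e, he, rfl⟩ := (hloc v).surjOn hq'.1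
    obtain ⟨q, hq, rfl⟩ := ih (v := Γ.rng e) (by simpa only [β.hrng] using hq'.2)
    exact ⟨e :: q, ⟨he, hq⟩, rfl⟩

theorem pmap_injOn
    (hloc : ∀ v : Γ.V, Set.BijOn β.emap {e | Γ.src e = v} {e' | Λ.src e' = β.vmap v})
    (v : Γ.V) : Set.InjOn β.pmap {p | Γ.IsPathFrom v p} := by
  intro p hp q hq h
  induction p generalizing v q with
  | nil => exact (List.map_eq_nil_iff.mp h.symm).symm
  | cons e l ih =>
    cases q with
    | nil => simp [pmap] at h
    | cons f m =>
      obtain ⟨hef, hlm⟩ := List.cons.inj h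
      obtain rfl := (hloc v).injOn hp.1 hq.1 hef
      rw [ih (Γ.rng e) hp.2 hq.2 hlm]

end GraphHom

theorem Arrow.exists_act_singleton {Γ : DirGraph} (g : Arrow Γ) {e : Γ.E}
    (he : Γ.src e = g.dom) : ∃ e', g.act [e] = [e'] := by
  simpa [g.act_nil] using g.act_snoc [] e ⟨he, trivial⟩

namespace AssocISG

variable {Γ : DirGraph} {Gs : SSG Γ} (T : AssocISG Γ Gs)

theorem P_cons (v : Γ.V) (e : Γ.E) (l : List Γ.E) :
    T.P v (e :: l) = T.mul (T.ιE e) (T.P (Γ.rng e) l) := rfl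

theorem ιG_mul_ιV {g : Arrow Γ} (hg : g ∈ Gs.carrier) :
    T.mul (T.ιG g) (T.ιV g.dom) = T.ιG g := by
  rw [← T.rel_id]
  exact T.rel_comp g _ g hg (Gs.id_mem _) ⟨rfl, rfl, rfl, fun _ _ => rfl⟩

theorem ιV_mul_ιG {g : Arrow Γ} (hg : g ∈ Gs.carrier) :
    T.mul (T.ιV g.cod) (T.ιG g) = T.ιG g := by
  rw [← T.rel_id]
  exact T.rel_comp _ g g (Gs.id_mem _) hg ⟨rfl, rfl, rfl, fun _ _ => rfl⟩

/-- A groupoid element moves past a path at the cost of restricting to it. -/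
theorem exists_ιG_mul_P {g : Arrow Γ} (hg : g ∈ Gs.carrier) {p : List Γ.E}
    (hp : Γ.IsPathFrom g.dom p) :
    ∃ h ∈ Gs.carrier, g.IsRestrictOf p h ∧
      T.mul (T.ιG g) (T.P g.dom p) = T.mul (T.P g.cod (g.act p)) (T.ιG h) := by
  induction p generalizing g with
  | nil =>
    refine ⟨g, hg, ⟨rfl, by rw [g.act_nil]; rfl, fun q _ => by rw [g.act_nil]; rfl⟩, ?_⟩
    rw [g.act_nil]
    exact (T.ιG_mul_ιV hg).trans (T.ιV_mul_ιG hg).symm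
  | cons e l ih =>
    obtain ⟨he, hl⟩ := hp
    obtain ⟨e', he'⟩ := g.exists_act_singleton he
    obtain ⟨h, hh, hres⟩ := Gs.restrict_mem g hg e he
    obtain ⟨hdom, hcod, hact⟩ := id hres
    rw [he'] at hcod
    change h.dom = Γ.rng e at hdom
    change h.cod = Γ.rng e' at hcod
    have hact' : ∀ q, Γ.IsPathFrom (Γ.rng e) q → g.act (e :: q) = e' :: h.act q := by
      intro q hq
      simpa [he'] using hact q hq
    obtain ⟨k, hk, ⟨kdom, kcod, kact⟩, hmul⟩ := ih hh (hdom ▸ hl)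
    rw [hdom] at kdom kact hmul
    rw [hcod] at kcod hmul
    refine ⟨k, hk, ⟨kdom, by rw [hact' l hl]; exact kcod, fun q hq => ?_⟩, ?_⟩
    · rw [List.cons_append, hact' _ ((Γ.isPathFrom_append _ _ _).2 ⟨hl, hq⟩), kact q hq,
        hact' l hl, List.cons_append]
    · rw [hact' l hl, P_cons, P_cons, ← T.mul_assoc, T.rel_ge g hg e e' h he he' hres,
        T.mul_assoc, hmul, T.mul_assoc]

theorem P_mul_ιG_eq_canonical {v : Γ.V} {p : List Γ.E} {h : Arrow Γ} (hh : h ∈ Gs.carrier) :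
    T.mul (T.P v p) (T.ιG h) =
      T.mul (T.mul (pathProd T.mul T.ιV T.ιE v p) (T.ιG h))
        (T.star (pathProd T.mul T.ιV T.ιE h.dom [])) := by
  change _ = T.mul (T.mul (T.P v p) (T.ιG h)) (T.star (T.ιV h.dom))
  rw [T.rel_star_v, T.mul_assoc, T.ιG_mul_ιV hh]

theorem ιG_mul_P_ne_zero {g : Arrow Γ} (hg : g ∈ Gs.carrier) {p : List Γ.E}
    (hp : Γ.IsPathFrom g.dom p) : T.mul (T.ιG g) (T.P g.dom p) ≠ T.zero := by
  obtain ⟨h, hh, ⟨-, hcod, -⟩, hmul⟩ := T.exists_ιG_mul_P hg hp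
  rw [hmul, T.P_mul_ιG_eq_canonical hh]
  exact T.canon_nonzero _ _ _ _ _ (g.act_maps _ hp) trivial hh rfl hcod

/-- Two isotropy elements agree on a path in `S` iff they act equally on all its extensions. -/
theorem ιG_mul_P_eq_iff {v : Γ.V} {g g' : Arrow Γ} (hg : g ∈ Gs.carrier)
    (hg' : g' ∈ Gs.carrier) (hd : g.dom = v) (hc : g.cod = v) (hd' : g'.dom = v)
    (hc' : g'.cod = v) {p : List Γ.E} (hp : Γ.IsPathFrom v p) :
    T.mul (T.ιG g) (T.P v p) = T.mul (T.ιG g') (T.P v p) ↔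
      ∀ q, Γ.IsPathFrom (Γ.rng0 v p) q → g.act (p ++ q) = g'.act (p ++ q) := by
  have hgp := hc ▸ g.act_maps p (hd.symm ▸ hp)
  have hgp' := hc' ▸ g'.act_maps p (hd'.symm ▸ hp)
  obtain ⟨h, hh, ⟨hdom, hcod, hact⟩, hmul⟩ := T.exists_ιG_mul_P hg (hd.symm ▸ hp)
  obtain ⟨h', hh', ⟨hdom', hcod', hact'⟩, hmul'⟩ := T.exists_ιG_mul_P hg' (hd'.symm ▸ hp)
  rw [hd] at hdom hact hmul
  rw [hd'] at hdom' hact' hmul'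
  rw [hc] at hcod hmul
  rw [hc'] at hcod' hmul'
  rw [hmul, hmul']
  constructor
  · intro heq q hq
    rw [T.P_mul_ιG_eq_canonical hh, T.P_mul_ιG_eq_canonical hh'] at heq
    obtain ⟨-, -, hpp, -, -, -, hsame⟩ := T.canon_inj v h.dom v h'.dom _ [] _ [] h h'
      hgp trivial hh rfl hcod hgp' trivial hh' rfl hcod' heq
    rw [hact q hq, hact' q hq, hpp, hsame q (hdom.symm ▸ hq)]
  · intro heq
    have hpp : g.act p = g'.act p := by simpa using heq [] trivial
    have hsame : h.Same h' := by
      refine ⟨hdom.trans hdom'.symm, by rw [hcod, hcod', hpp], fun q hq => ?_⟩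
      rw [hdom] at hq
      have := heq q hq
      rwa [hact q hq, hact' q hq, hpp, List.append_cancel_left_eq] at this
    rw [hpp, T.ιG_same _ _ hsame]

end AssocISG

open Classical in
theorem ContractedAlg.sum_smul_δ_eq_zero_iff {K : Type} [Field K] {Γ : DirGraph} {Gs : SSG Γ}
    {T : AssocISG Γ Gs} (C : ContractedAlg K T) {ι : Type*} (I : Finset ι) (c : ι → K)
    (s : ι → T.S) (hs : ∀ i ∈ I, s i ≠ T.zero) :
    ∑ i ∈ I, c i • C.δ (s i) = 0 ↔ ∀ j ∈ I, ∑ i ∈ I with s i = s j, c i = 0 := by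
  have hsum : ∑ i ∈ I, c i • C.δ (s i) =
      ∑ t ∈ I.image s, (∑ i ∈ I with s i = t, c i) • C.δ t := by
    rw [← Finset.sum_fiberwise_of_maps_to fun i hi => Finset.mem_image_of_mem s hi]
    refine Finset.sum_congr rfl fun t _ => ?_
    rw [Finset.sum_smul]
    exact Finset.sum_congr rfl fun i hi => by rw [(Finset.mem_filter.1 hi).2]
  rw [hsum, ← Finset.forall_mem_image (s := I) (f := s)
    (p := fun t => ∑ i ∈ I with s i = t, c i = 0)]
  refine ⟨fun h => ?_, fun h => Finset.sum_eq_zero fun t ht => by rw [h t ht, zero_smul]⟩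
  have hindep : LinearIndepOn K C.δ {t | t ≠ T.zero} := C.indep
  have hsub : ((I.image s : Finset T.S) : Set T.S) ⊆ {t | t ≠ T.zero} := by
    intro t ht
    obtain ⟨i, hi, rfl⟩ := Finset.mem_image.1 ht
    exact hs i hi
  intro t ht
  exact linearIndepOn_finset_iff.1 (hindep.mono hsub) _ h t ht

/-! ## STATEMENT 10 -/

/-- Theorem: for `H = G ∩ Iso(v, v)` the isotropy group at `v`, `a ∈ K H` and `p ∈ vΓ*`:
`a p = 0` in `K S_{(G,Γ*)}` iff `α(a) β(p) = 0` in `K S_{(L,Λ*)}` (with `a` written as a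
finite linear combination `∑_{g} c_g g` of elements of `H` and `α` extended linearly). -/
theorem statement10 (K : Type) [Field K] (Γ Λ : DirGraph) (Gs : SSG Γ)
    (F : Set (Arrow Γ)) (β : GraphHom Γ Λ) (hF : IsFsystem Gs F) (hβ : IsCollapse Gs F β)
    (Ls : SSG Λ) (hLs : Ls.carrier = Lcarrier Gs β)
    (T : AssocISG Γ Gs) (TL : AssocISG Λ Ls)
    (C : ContractedAlg K T) (CL : ContractedAlg K TL)
    (v : Γ.V) (π : Arrow Γ → Arrow Λ)
    (hπ : ∀ g, g ∈ Gs.carrier → g.dom = v → g.cod = v → IsPushArrow β g (π g))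
    (Tset : Finset (Arrow Γ)) (c : Arrow Γ → K)
    (hTset : ∀ g ∈ Tset, g ∈ Gs.carrier ∧ g.dom = v ∧ g.cod = v)
    (p : List Γ.E) (hp : Γ.IsPathFrom v p) :
    (∑ g ∈ Tset, c g • C.δ (T.ιG g)) * C.δ (T.P v p) = 0 ↔
      (∑ g ∈ Tset, c g • CL.δ (TL.ιG (π g))) * CL.δ (TL.P (β.vmap v) (β.pmap p)) = 0 := by
  have hpd : ∀ g ∈ Tset, π g ∈ Ls.carrier ∧ (π g).dom = β.vmap v ∧ (π g).cod = β.vmap v ∧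
      ∀ l, Γ.IsPathFrom v l → (π g).act (β.pmap l) = β.pmap (g.act l) := by
    intro g hg
    obtain ⟨hgG, hd, hc⟩ := hTset g hg
    have hpush := hπ g hgG hd hc
    refine ⟨hLs ▸ ⟨g, hgG, hpush⟩, ?_⟩
    obtain ⟨h1, h2, h3⟩ := hpush
    rw [hd] at h1 h3
    rw [hc] at h2
    exact ⟨h1, h2, h3⟩
  have hβp := β.isPathFrom_pmap hp
  have hloc := hβ.2.1
  have hiff : ∀ g ∈ Tset, ∀ g' ∈ Tset,
      T.mul (T.ιG g) (T.P v p) = T.mul (T.ιG g') (T.P v p) ↔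
        TL.mul (TL.ιG (π g)) (TL.P (β.vmap v) (β.pmap p)) =
          TL.mul (TL.ιG (π g')) (TL.P (β.vmap v) (β.pmap p)) := by
    intro g hg g' hg'
    obtain ⟨hgG, hd, hc⟩ := hTset g hg
    obtain ⟨hgG', hd', hc'⟩ := hTset g' hg'
    obtain ⟨hL, hLd, hLc, hLact⟩ := hpd g hg
    obtain ⟨hL', hLd', hLc', hLact'⟩ := hpd g' hg'
    rw [T.ιG_mul_P_eq_iff hgG hgG' hd hc hd' hc' hp,
      TL.ιG_mul_P_eq_iff hL hL' hLd hLc hLd' hLc' hβp, β.rng0_pmap]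
    constructor
    · intro h q' hq'
      obtain ⟨q, hq, rfl⟩ := GraphHom.exists_pmap_eq hloc hq'
      have hpq := (Γ.isPathFrom_append v p q).2 ⟨hp, hq⟩
      rw [← β.pmap_append, hLact _ hpq, hLact' _ hpq, h q hq]
    · intro h q hq
      have hpq := (Γ.isPathFrom_append v p q).2 ⟨hp, hq⟩
      have heq := h (β.pmap q) (β.isPathFrom_pmap hq)
      rw [← β.pmap_append, hLact _ hpq, hLact' _ hpq] at heq
      exact GraphHom.pmap_injOn hloc v (hc ▸ g.act_maps _ (hd.symm ▸ hpq))
        (hc' ▸ g'.act_maps _ (hd'.symm ▸ hpq)) heq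
  simp only [Finset.sum_mul, C.smul_mul, CL.smul_mul, ← C.δ_mul, ← CL.δ_mul]
  rw [C.sum_smul_δ_eq_zero_iff Tset c (fun g => T.mul (T.ιG g) (T.P v p)),
    CL.sum_smul_δ_eq_zero_iff Tset c
      (fun g => TL.mul (TL.ιG (π g)) (TL.P (β.vmap v) (β.pmap p)))]
  · refine forall₂_congr fun j hj => ?_
    classical rw [Finset.filter_congr fun i hi => hiff i hi j hj]
  · intro g hg
    obtain ⟨hL, hLd, -, -⟩ := hpd g hg
    rw [← hLd] at hβp ⊢
    exact TL.ιG_mul_P_ne_zero hL hβp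
  · intro g hg
    obtain ⟨hgG, rfl, -⟩ := hTset g hg
    exact T.ιG_mul_P_ne_zero hgG hp
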